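/- Let k ≥ 0 be an integer such that ker(M^(k+1)) = ker(M^k) (equivalently, k is at least the maximal size of a Jordan block of M corresponding to the eigenvalue 0). Then the program scheme is terminating, i.e. for every density matrix ρ there exists an integer n ≥ 1 with tr(E₁(Gⁿ⁻¹(ρ))) = 0, if and only if M^k · Φ = 0. -/

import Mathlib

open Matrix Kronecker Filter Topology
open scoped ComplexOrder

/-- The completely positive map `σ ↦ ∑ i, A i * σ * (A i)ᴴ` with Kraus operators `A`. -/
def krausMap {n ι : Type*} [Fintype n] [Fintype ι] (A : ι → Matrix n n ℂ) :
    Matrix n n ℂ →ₗ[ℂ] Matrix n n ℂ where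
  toFun σ := ∑ i, A i * σ * (A i)ᴴ
  map_add' σ τ := by simp [mul_add, add_mul, Finset.sum_add_distrib]
  map_smul' c σ := by simp [Finset.smul_sum]

section KrausMap

variable {n ι : Type*} [Fintype n] [Fintype ι] (A : ι → Matrix n n ℂ)

theorem krausMap_apply (σ : Matrix n n ℂ) : krausMap A σ = ∑ i, A i * σ * (A i)ᴴ := rfl

theorem Matrix.PosSemidef.krausMap_iterate {σ : Matrix n n ℂ} (hσ : σ.PosSemidef) (m : ℕ) :
    ((krausMap A)^[m] σ).PosSemidef := by
  induction m with
  | zero => exact hσ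
  | succ m ih =>
    rw [Function.iterate_succ_apply', krausMap_apply]
    exact posSemidef_sum _ fun i _ => ih.mul_mul_conjTranspose_same (A i)

/-- The Kronecker matrix of a Kraus map acts on row-major vectorizations as the map itself. -/
theorem sum_kronecker_mulVec (σ : Matrix n n ℂ) :
    (∑ i, A i ⊗ₖ (A i).map (starRingEnd ℂ)) *ᵥ (fun p : n × n => σ p.1 p.2) =
      fun p => krausMap A σ p.1 p.2 := by
  ext ⟨a, b⟩
  simp only [krausMap_apply, sum_mulVec, Finset.sum_apply, Matrix.sum_apply]
  refine Finset.sum_congr rfl fun i _ => ?_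
  simp only [mulVec, dotProduct, mul_apply, kroneckerMap_apply, map_apply, conjTranspose_apply,
    Fintype.sum_prod_type, Finset.sum_mul, starRingEnd_apply]
  rw [Finset.sum_comm]
  exact Finset.sum_congr rfl fun x _ => Finset.sum_congr rfl fun y _ => by ring

theorem sum_kronecker_pow_mulVec [DecidableEq n] (σ : Matrix n n ℂ) (m : ℕ) :
    ((∑ i, A i ⊗ₖ (A i).map (starRingEnd ℂ)) ^ m) *ᵥ (fun p : n × n => σ p.1 p.2) =
      fun p => (krausMap A)^[m] σ p.1 p.2 := by
  induction m with
  | zero => simp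
  | succ m ih =>
    rw [pow_succ', ← mulVec_mulVec, ih, sum_kronecker_mulVec, Function.iterate_succ_apply']

theorem sum_kronecker_pow_mulVec_one [DecidableEq n] (m : ℕ) :
    ((∑ i, A i ⊗ₖ (A i).map (starRingEnd ℂ)) ^ m) *ᵥ
        (fun p : n × n => if p.1 = p.2 then (1 : ℂ) else 0) = 0 ↔
      (krausMap A)^[m] 1 = 0 := by
  have h := sum_kronecker_pow_mulVec A 1 m
  simp only [one_apply] at h
  rw [h]
  refine ⟨fun h0 => ?_, fun h0 => ?_⟩
  · ext a b
    exact congrFun h0 (a, b)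
  · ext p
    simp [h0]

open scoped MatrixOrder Matrix.Norms.L2Operator in
/-- A Hermitian matrix is dominated by a scalar multiple of the identity. -/
theorem Matrix.IsHermitian.exists_posSemidef_smul_one_sub [DecidableEq n] {σ : Matrix n n ℂ}
    (hσ : σ.IsHermitian) : ∃ c : ℂ, (c • (1 : Matrix n n ℂ) - σ).PosSemidef := by
  refine ⟨(‖σ‖ : ℝ), ?_⟩
  have h := IsSelfAdjoint.le_algebraMap_norm_self (a := σ) hσ
  rw [Matrix.le_iff, Algebra.algebraMap_eq_smul_one] at h
  simpa using h

theorem krausMap_iterate_eq_zero_of_one [DecidableEq n] {m : ℕ} (h : (krausMap A)^[m] 1 = 0)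
    {σ : Matrix n n ℂ} (hσ : σ.PosSemidef) : (krausMap A)^[m] σ = 0 := by
  obtain ⟨c, hc⟩ := hσ.isHermitian.exists_posSemidef_smul_one_sub
  have hneg := hc.krausMap_iterate A m
  have hpos := hσ.krausMap_iterate A m
  rw [← Module.End.coe_pow] at h hneg hpos ⊢
  rw [map_sub, map_smul, h, smul_zero, zero_sub] at hneg
  refine hpos.trace_eq_zero_iff.mp (le_antisymm ?_ hpos.trace_nonneg)
  simpa using hneg.trace_nonneg

end KrausMap

/-- Once the kernels of the powers of a matrix stabilize, they stay constant. -/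
theorem Matrix.pow_mulVec_eq_zero_of_ker_eq {n R : Type*} [Fintype n] [DecidableEq n]
    [CommRing R] {M : Matrix n n R} {k : ℕ}
    (hk : LinearMap.ker (mulVecLin (M ^ (k + 1))) = LinearMap.ker (mulVecLin (M ^ k)))
    {v : n → R} {m : ℕ} (hv : (M ^ m) *ᵥ v = 0) : (M ^ k) *ᵥ v = 0 := by
  induction m generalizing v with
  | zero => simp_all
  | succ m ih =>
    have h : (M ^ k) *ᵥ (M *ᵥ v) = 0 := ih (by rwa [mulVec_mulVec, ← pow_succ])
    rw [mulVec_mulVec, ← pow_succ] at h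
    have hmem : v ∈ LinearMap.ker (mulVecLin (M ^ (k + 1))) := h
    rwa [hk] at hmem

theorem stmt18 (d : ℕ) (hd : 0 < d) (ι : Type) [Fintype ι]
    (E : ι → Matrix (Fin d) (Fin d) ℂ) (hE : ∑ i, (E i)ᴴ * E i = 1)
    (M0 M1 : Matrix (Fin d) (Fin d) ℂ) (hM : M0ᴴ * M0 + M1ᴴ * M1 = 1)
    (k : ℕ)
    (hk : LinearMap.ker (Matrix.mulVecLin ((∑ i, (E i * M1) ⊗ₖ (E i * M1).map (starRingEnd ℂ)) ^ (k + 1))) =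
        LinearMap.ker (Matrix.mulVecLin ((∑ i, (E i * M1) ⊗ₖ (E i * M1).map (starRingEnd ℂ)) ^ k))) :
    (∀ ρ : Matrix (Fin d) (Fin d) ℂ, ρ.PosSemidef → ρ.trace = 1 →
        ∃ n : ℕ, 1 ≤ n ∧ (M1 * ((fun ρ : Matrix (Fin d) (Fin d) ℂ => ∑ i, (E i * M1) * ρ * (E i * M1)ᴴ)^[n - 1] ρ) * M1ᴴ).trace = 0) ↔
      ((∑ i, (E i * M1) ⊗ₖ (E i * M1).map (starRingEnd ℂ)) ^ k) *ᵥ (fun p : Fin d × Fin d => if p.1 = p.2 then (1 : ℂ) else 0) = 0 := by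
  rw [sum_kronecker_pow_mulVec_one]
  change (∀ ρ : Matrix (Fin d) (Fin d) ℂ, ρ.PosSemidef → ρ.trace = 1 → ∃ n : ℕ, 1 ≤ n ∧
    (M1 * ((krausMap fun i => E i * M1)^[n - 1] ρ) * M1ᴴ).trace = 0) ↔ _
  constructor
  · intro h
    have hd0 : (d : ℂ) ≠ 0 := Nat.cast_ne_zero.mpr hd.ne'
    have hρ : ((d : ℂ)⁻¹ • (1 : Matrix (Fin d) (Fin d) ℂ)).PosSemidef :=
      PosSemidef.one.smul (by positivity)
    obtain ⟨n, hn, htr⟩ := h _ hρ (by simp [hd0])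
    obtain ⟨m, rfl⟩ := Nat.exists_eq_add_of_le' hn
    rw [Nat.add_sub_cancel,
      ((hρ.krausMap_iterate _ m).mul_mul_conjTranspose_same M1).trace_eq_zero_iff] at htr
    have hzero : (krausMap fun i => E i * M1)^[m + 1] ((d : ℂ)⁻¹ • 1) = 0 := by
      rw [Function.iterate_succ_apply', krausMap_apply]
      refine Finset.sum_eq_zero fun i _ => ?_
      rw [conjTranspose_mul, mul_assoc (E i), mul_assoc (E i), ← mul_assoc (M1 * _), htr]
      simp
    rw [← Module.End.coe_pow, map_smul, smul_eq_zero, Module.End.coe_pow] at hzero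
    have hone := hzero.resolve_left (inv_ne_zero hd0)
    rw [← sum_kronecker_pow_mulVec_one] at hone ⊢
    exact pow_mulVec_eq_zero_of_ker_eq hk hone
  · intro h ρ hρ _
    refine ⟨k + 1, Nat.le_add_left 1 k, ?_⟩
    rw [Nat.add_sub_cancel, krausMap_iterate_eq_zero_of_one _ h hρ]
    simp
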